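/- Fix b ≠ 0, ω irrational, a ∈ ℝ, φ ∈ ℝ. The Almost Mathieu eigenvalue equation x_{n+1} + x_{n-1} + b·cos(2πωn + φ)·x_n = a·x_n cannot have two linearly independent solutions both of the form x_n = (−1)^n·ψ(2πωn + φ) with ψ continuous on the circle. -/

import Mathlib

open MeasureTheory Filter Topology AddCircle in
lemma am_coeff_shift {T : ℝ} [hT : Fact (0 < T)] (f : AddCircle T → ℂ) (α : AddCircle T) (k : ℤ) :
    fourierCoeff (fun t => f (t + α)) k = fourier k α * fourierCoeff f k := by
  unfold fourierCoeff
  rw [← integral_const_mul,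
    ← integral_add_right_eq_self (fun t => fourier k α * (fourier (-k) t • f t)) α]
  congr 1
  ext t
  have h1 : (fourier (-k) (t + α) : ℂ) = fourier (-k) t * fourier (-k) α := by
    simp only [fourier_apply, zsmul_add, toCircle_add, Circle.coe_mul]
  have h2 : (fourier k α : ℂ) * fourier (-k) α = 1 := by
    rw [← fourier_add]; simp
  rw [h1, smul_eq_mul, smul_eq_mul]
  linear_combination (-(fourier (-k) t * f (t + α))) * h2

open MeasureTheory AddCircle in
lemma am_coeff_mul {T : ℝ} [hT : Fact (0 < T)] (f : AddCircle T → ℂ) (m k : ℤ) :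
    fourierCoeff (fun t => fourier m t * f t) k = fourierCoeff f (k - m) := by
  unfold fourierCoeff
  congr 1
  ext t
  rw [show -(k - m) = -k + m by ring, fourier_add]
  simp only [smul_eq_mul]
  ring

open MeasureTheory AddCircle in
lemma am_recurrence {T : ℝ} [hT : Fact (0 < T)] (f : AddCircle T → ℂ) (hf : Continuous f)
    (α : AddCircle T) (a b : ℂ)
    (h : ∀ t, f (t + α) + f (t + -α) + a * f t
      = b * (fourier 1 t * f t) + b * (fourier (-1) t * f t)) (k : ℤ) :
    (fourier k α + fourier k (-α) + a) * fourierCoeff f k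
      = b * (fourierCoeff f (k - 1) + fourierCoeff f (k + 1)) := by
  have I : ∀ g : AddCircle T → ℂ, Continuous g → Integrable g haarAddCircle := fun g hg =>
    (hg.integrable_of_hasCompactSupport (HasCompactSupport.of_compactSpace g))
  have e := congrArg (fun g => fourierCoeff g k) (funext h)
  have c1 : Continuous fun t => f (t + α) := by fun_prop
  have c2 : Continuous fun t => f (t + -α) := by fun_prop
  have c3 : Continuous fun t => a * f t := by fun_prop
  have c4 : Continuous fun t => b * (fourier 1 t * f t) := by fun_prop
  have c5 : Continuous fun t => b * (fourier (-1) t * f t) := by fun_prop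
  have a1 := congrFun (fourierCoeff.add (I _ (c1.add c2)) (I _ c3)) k
  have a2 := congrFun (fourierCoeff.add (I _ c1) (I _ c2)) k
  have a3 := congrFun (fourierCoeff.add (I _ c4) (I _ c5)) k
  simp only [Pi.add_apply] at a1 a2 a3
  have e' : fourierCoeff ((fun t => f (t + α)) + (fun t => f (t + -α)) + fun t => a * f t) k =
    fourierCoeff ((fun t => b * (fourier 1 t * f t)) + fun t => b * (fourier (-1) t * f t)) k := e
  have a1' : fourierCoeff ((fun t => f (t + α)) + (fun t => f (t + -α)) + fun t => a * f t) k = _ := a1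
  have a2' : _ = _ := a2
  rw [a1', a3] at e'
  erw [a2'] at e'
  rw [am_coeff_shift, am_coeff_shift, fourierCoeff.const_mul, fourierCoeff.const_mul,
    fourierCoeff.const_mul, am_coeff_mul, am_coeff_mul, sub_neg_eq_add] at e'
  linear_combination e'

open MeasureTheory Filter Topology AddCircle in
lemma am_tendsto {T : ℝ} [hT : Fact (0 < T)] (f : C(AddCircle T, ℂ)) :
    Tendsto (fourierCoeff f) cofinite (𝓝 0) := by
  have h := (hasSum_sq_fourierCoeff (ContinuousMap.toLp (E := ℂ) 2 haarAddCircle ℂ f)).summable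
  simp_rw [fourierCoeff_toLp] at h
  have h2 := h.tendsto_cofinite_zero
  rw [tendsto_zero_iff_norm_tendsto_zero]
  have h3 := h2.sqrt
  simpa using h3

open Filter Topology in
lemma am_dep (c d V : ℤ → ℂ) (b : ℂ) (hb : b ≠ 0)
    (hc : ∀ k, V k * c k = b * (c (k - 1) + c (k + 1)))
    (hd : ∀ k, V k * d k = b * (d (k - 1) + d (k + 1)))
    (tc : Tendsto c cofinite (𝓝 0)) (td : Tendsto d cofinite (𝓝 0)) :
    ∃ s t : ℂ, (s ≠ 0 ∨ t ≠ 0) ∧ ∀ k, s * c k + t * d k = 0 := by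
  have W1 : ∀ k, c k * d (k + 1) - c (k + 1) * d k = c (k - 1) * d k - c k * d (k - 1) := by
    intro k
    apply mul_left_cancel₀ hb
    linear_combination d k * hc k - c k * hd k
  have W2 : ∀ k, c k * d (k + 1) - c (k + 1) * d k = c 0 * d 1 - c 1 * d 0 := by
    intro k
    induction k using Int.induction_on with
    | zero => simp
    | succ i ih => rw [W1]; simpa using ih
    | pred i ih => rw [W1] at ih; simpa using ih
  have ts : Tendsto (fun k : ℤ => k + 1) cofinite cofinite :=
    (add_left_injective (1 : ℤ)).tendsto_cofinite
  have W3 : Tendsto (fun k => c k * d (k + 1) - c (k + 1) * d k) cofinite (𝓝 0) := by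
    simpa using (tc.mul (td.comp ts)).sub ((tc.comp ts).mul td)
  have W4 : c 0 * d 1 - c 1 * d 0 = 0 := by
    simp_rw [W2] at W3
    exact tendsto_nhds_unique tendsto_const_nhds W3
  by_cases h0 : ∀ k, c k = 0
  · exact ⟨1, 0, by simp, by simp [h0]⟩
  push Not at h0
  obtain ⟨m, hm⟩ := h0
  refine ⟨d m, -c m, Or.inr (neg_ne_zero.mpr hm), ?_⟩
  have E : ∀ k, V k * (d m * c k + -c m * d k)
      = b * ((d m * c (k-1) + -c m * d (k-1)) + (d m * c (k+1) + -c m * d (k+1))) := by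
    intro k
    linear_combination d m * hc k - c m * hd k
  have key : ∀ j : ℤ, (d m * c (m + j) + -c m * d (m + j) = 0) ∧
      (d m * c (m + j + 1) + -c m * d (m + j + 1) = 0) := by
    intro j
    induction j using Int.induction_on with
    | zero =>
      rw [add_zero]
      refine ⟨by ring, ?_⟩
      have := W2 m
      rw [W4] at this
      linear_combination -this
    | succ i ih =>
      refine ⟨by rw [← add_assoc]; exact ih.2, ?_⟩
      have e := E (m + i + 1)
      rw [ih.2, add_sub_cancel_right, ih.1] at e
      rw [← add_assoc]
      simpa [hb] using e
    | pred i ih =>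
      have e := E (m + -i)
      rw [ih.1, ih.2] at e
      refine ⟨?_, ?_⟩
      · rw [show m + (-(i:ℤ) - 1) = m + -i - 1 by ring]
        simpa [hb] using e
      · rw [show m + (-(i:ℤ) - 1) + 1 = m + -i by ring]
        exact ih.1
  intro k
  simpa using (key (k - m)).1

open AddCircle in
lemma am_functional (a b ω φ : ℝ) (hω : Irrational ω) (x : ℤ → ℝ)
    (hx : ∀ n : ℤ, x (n + 1) + x (n - 1)
      + b * Real.cos (2 * Real.pi * ω * n + φ) * x n = a * x n)
    (ψ : AddCircle (2 * Real.pi) → ℝ) (hψ : Continuous ψ)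
    (hxqp : ∀ n : ℤ, x n = (-1 : ℝ) ^ n * ψ ((2 * Real.pi * ω * n + φ : ℝ)))
    (t : AddCircle (2 * Real.pi)) :
    (ψ (t + ((2 * Real.pi * ω : ℝ) : AddCircle (2 * Real.pi))) : ℂ)
      + (ψ (t + -((2 * Real.pi * ω : ℝ) : AddCircle (2 * Real.pi))) : ℂ) + (a : ℂ) * (ψ t : ℂ)
      = (b / 2 : ℂ) * (fourier 1 t * (ψ t : ℂ)) + (b / 2 : ℂ) * (fourier (-1) t * (ψ t : ℂ)) := by
  have hd : DenseRange (· • ((2 * Real.pi * ω : ℝ) : AddCircle (2 * Real.pi)) :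
      ℤ → AddCircle (2 * Real.pi)) := by
    rw [denseRange_zsmul_coe_iff]
    rwa [mul_div_cancel_left₀ _ (by positivity)]
  have hd2 : DenseRange (fun n : ℤ => n • ((2 * Real.pi * ω : ℝ) : AddCircle (2 * Real.pi))
      + (φ : AddCircle (2 * Real.pi))) :=
    (Homeomorph.addRight (φ : AddCircle (2 * Real.pi))).surjective.denseRange.comp hd
      (Homeomorph.addRight _).continuous
  refine congrFun (hd2.equalizer (g := fun t => (ψ (t + ((2 * Real.pi * ω : ℝ) : AddCircle (2 * Real.pi))) : ℂ)
      + (ψ (t + -((2 * Real.pi * ω : ℝ) : AddCircle (2 * Real.pi))) : ℂ) + (a : ℂ) * (ψ t : ℂ))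
      (h := fun t => (b / 2 : ℂ) * (fourier 1 t * (ψ t : ℂ)) + (b / 2 : ℂ) * (fourier (-1) t * (ψ t : ℂ)))
      (by fun_prop) (by fun_prop) ?_) t
  ext n
  simp only [Function.comp_apply]
  have p0 : n • ((2 * Real.pi * ω : ℝ) : AddCircle (2 * Real.pi)) + (φ : AddCircle (2 * Real.pi))
      = ((2 * Real.pi * ω * n + φ : ℝ) : AddCircle (2 * Real.pi)) := by
    rw [← AddCircle.coe_zsmul, ← AddCircle.coe_add, zsmul_eq_mul, mul_comm (n : ℝ)]
  rw [p0, ← AddCircle.coe_neg, ← AddCircle.coe_add, ← AddCircle.coe_add]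
  have h := hx n
  rw [hxqp, hxqp, hxqp n, zpow_add₀ (by norm_num), zpow_sub₀ (by norm_num)] at h
  have q1 : 2 * Real.pi * ω * ((n + 1 : ℤ) : ℝ) + φ = 2 * Real.pi * ω * n + φ + 2 * Real.pi * ω := by
    push_cast; ring
  have q2 : 2 * Real.pi * ω * ((n - 1 : ℤ) : ℝ) + φ = 2 * Real.pi * ω * n + φ + -(2 * Real.pi * ω) := by
    push_cast; ring
  rw [q1, q2] at h
  set θ := 2 * Real.pi * ω * n + φ
  have hs : ((-1 : ℝ) ^ n) ≠ 0 := zpow_ne_zero _ (by norm_num)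
  have h' : ψ ((θ + 2 * Real.pi * ω : ℝ)) + ψ ((θ + -(2 * Real.pi * ω) : ℝ)) + a * ψ (θ : ℝ)
      = b * Real.cos θ * ψ (θ : ℝ) := by
    apply mul_left_cancel₀ hs
    rw [zpow_one] at h
    linear_combination -h
  have hC := congrArg (fun r : ℝ => (r : ℂ)) h'
  push_cast at hC
  have hp : (Real.pi : ℂ) ≠ 0 := by exact_mod_cast Real.pi_ne_zero
  have f1 : (fourier 1 (θ : AddCircle (2 * Real.pi)) : ℂ) = Complex.exp (θ * Complex.I) := by
    rw [fourier_coe_apply]; congr 1; push_cast; field_simp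
  have f2 : (fourier (-1) (θ : AddCircle (2 * Real.pi)) : ℂ) = Complex.exp (-θ * Complex.I) := by
    rw [fourier_coe_apply]; congr 1; push_cast; field_simp
  rw [f1, f2, hC, Complex.cos]
  ring

/-- The Almost Mathieu equation (b ≠ 0, ω irrational) cannot have two
linearly independent solutions both of the "anti-periodic" form (−1)^n ψ(2πωn + φ). -/
theorem no_coexistence_antiperiodic_solutions
    (a b ω φ : ℝ) (hb : b ≠ 0) (hω : Irrational ω)
    (x y : ℤ → ℝ)
    (hx : ∀ n : ℤ, x (n + 1) + x (n - 1)
      + b * Real.cos (2 * Real.pi * ω * n + φ) * x n = a * x n)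
    (hy : ∀ n : ℤ, y (n + 1) + y (n - 1)
      + b * Real.cos (2 * Real.pi * ω * n + φ) * y n = a * y n)
    (ψ χ : AddCircle (2 * Real.pi) → ℝ) (hψ : Continuous ψ) (hχ : Continuous χ)
    (hxqp : ∀ n : ℤ, x n = (-1 : ℝ) ^ n * ψ ((2 * Real.pi * ω * n + φ : ℝ)))
    (hyqp : ∀ n : ℤ, y n = (-1 : ℝ) ^ n * χ ((2 * Real.pi * ω * n + φ : ℝ))) :
    ¬ LinearIndependent ℝ ![x, y] := by
  have hT : Fact (0 < 2 * Real.pi) := ⟨by positivity⟩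
  let f : C(AddCircle (2 * Real.pi), ℂ) := ⟨fun t => (ψ t : ℂ), by fun_prop⟩
  let g : C(AddCircle (2 * Real.pi), ℂ) := ⟨fun t => (χ t : ℂ), by fun_prop⟩
  have rf := am_recurrence f f.continuous _ a (b / 2)
    (am_functional a b ω φ hω x hx ψ hψ hxqp)
  have rg := am_recurrence g g.continuous _ a (b / 2)
    (am_functional a b ω φ hω y hy χ hχ hyqp)
  obtain ⟨s, t, hst, h⟩ := am_dep _ _ _ _ (by simpa using hb) rf rg (am_tendsto f) (am_tendsto g)
  have hz : fourierCoeff (s • f + t • g : C(AddCircle (2 * Real.pi), ℂ)) = 0 := by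
    have I : ∀ g : C(AddCircle (2 * Real.pi), ℂ),
        MeasureTheory.Integrable g AddCircle.haarAddCircle := fun g =>
      (g.continuous.integrable_of_hasCompactSupport (HasCompactSupport.of_compactSpace g))
    ext k
    have e := congrFun (fourierCoeff.add (I (s • f)) (I (t • g))) k
    have e1 := fourierCoeff.const_smul f s k
    have e2 := fourierCoeff.const_smul g t k
    simp only [Pi.add_apply, ContinuousMap.coe_smul, ContinuousMap.coe_add] at e ⊢
    rw [e, e1, e2]
    exact h k
  have hp : ∀ θ, s * (ψ θ : ℂ) + t * (χ θ : ℂ) = 0 := by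
    intro θ
    have q := has_pointwise_sum_fourier_series_of_summable
      (f := s • f + t • g) (by rw [hz]; exact summable_zero) θ
    rw [hz] at q
    simp only [Pi.zero_apply, zero_smul] at q
    exact q.unique hasSum_zero
  intro hli
  rw [LinearIndependent.pair_iff] at hli
  have hre := hli s.re t.re (by
    ext n
    have this : ∀ θ, s.re * ψ θ + t.re * χ θ = 0 := fun θ => by
      simpa using congrArg Complex.re (hp θ)
    replace this := this ((2 * Real.pi * ω * n + φ : ℝ))
    simp only [Pi.add_apply, Pi.smul_apply, smul_eq_mul, hxqp, hyqp, Pi.zero_apply]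
    linear_combination (-1 : ℝ) ^ n * this)
  have him := hli s.im t.im (by
    ext n
    have this : ∀ θ, s.im * ψ θ + t.im * χ θ = 0 := fun θ => by
      simpa using congrArg Complex.im (hp θ)
    replace this := this ((2 * Real.pi * ω * n + φ : ℝ))
    simp only [Pi.add_apply, Pi.smul_apply, smul_eq_mul, hxqp, hyqp, Pi.zero_apply]
    linear_combination (-1 : ℝ) ^ n * this)
  rcases hst with hs | ht
  · exact hs (Complex.ext hre.1 him.1)
  · exact ht (Complex.ext hre.2 him.2)
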